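/- (Fused Ramanujan integral) Let τ ∈ ℍ, q = exp(2πiτ), q̃ = exp(-2πi/τ). Let 0 < |a|, |b| < 1 and |c|, |d| < |q̃|^{-1/2}. Then ∫_{-∞}^∞ [(-a q^{1/2+x}, -b q^{1/2-x}; q)_∞ · q^{x²/2}] / [(-q̃^{1/2} c e^{-2πix}, -q̃^{1/2} d e^{2πix}; q̃)_∞] dx = (1/√(-iτ)) · [(ab;q)_∞ (q̃c, q̃d; q̃)_∞] / [(q̃cd; q̃)_∞ (a, b; q)_∞]. -/

import Mathlib

open scoped Real

/-- The infinite q-Pochhammer symbol `(a;q)_∞ = ∏_{j=0}^∞ (1 - a q^j)`. -/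
noncomputable def qPochInf (a q : ℂ) : ℂ := ∏' n : ℕ, (1 - a * q ^ n)

open Filter Topology Finset MeasureTheory

lemma summable_norm_mul_pow_of_norm_lt_one {q : ℂ} (hq : ‖q‖ < 1) (a : ℂ) :
    Summable fun n : ℕ => ‖-(a * q ^ n)‖ := by
  simp only [norm_neg, norm_mul, norm_pow]
  exact (summable_geometric_of_lt_one (norm_nonneg q) hq).mul_left _

lemma tendsto_prod_qPochInf {q : ℂ} (hq : ‖q‖ < 1) (a : ℂ) :
    Tendsto (fun N => ∏ j ∈ range N, (1 - a * q ^ j)) atTop (𝓝 (qPochInf a q)) := by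
  have h := multipliable_one_add_of_summable (summable_norm_mul_pow_of_norm_lt_one hq a)
  simp only [← sub_eq_add_neg] at h
  exact h.hasProd.tendsto_prod_nat

lemma qPochInf_eq_one_sub_mul {q : ℂ} (hq : ‖q‖ < 1) (a : ℂ) :
    qPochInf a q = (1 - a) * qPochInf (a * q) q := by
  refine tendsto_nhds_unique ((tendsto_add_atTop_iff_nat 1).2 (tendsto_prod_qPochInf hq a)) ?_
  refine ((tendsto_prod_qPochInf hq (a * q)).const_mul (1 - a)).congr fun N => ?_
  rw [prod_range_succ', mul_comm, pow_zero, mul_one]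
  congr 1
  exact prod_congr rfl fun j _ => by ring

lemma norm_mul_pow_lt_one {a q : ℂ} (hq : ‖q‖ < 1) (ha : ‖a‖ < 1) (n : ℕ) : ‖a * q ^ n‖ < 1 := by
  rw [norm_mul, norm_pow]
  exact mul_lt_one_of_nonneg_of_lt_one_left (norm_nonneg _) ha (pow_le_one₀ (norm_nonneg q) hq.le)

lemma one_sub_mul_pow_ne_zero {a q : ℂ} (hq : ‖q‖ < 1) (ha : ‖a‖ < 1) (n : ℕ) :
    1 - a * q ^ n ≠ 0 := by
  intro h
  have h1 := norm_mul_pow_lt_one hq ha n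
  rw [← sub_eq_zero.1 h, norm_one] at h1
  exact lt_irrefl _ h1

lemma one_sub_pow_succ_ne_zero {q : ℂ} (hq : ‖q‖ < 1) (n : ℕ) : 1 - q ^ (n + 1) ≠ 0 := by
  rw [pow_succ']
  exact one_sub_mul_pow_ne_zero hq hq n

lemma qPochInf_ne_zero {a q : ℂ} (hq : ‖q‖ < 1) (ha : ‖a‖ < 1) : qPochInf a q ≠ 0 := by
  have h := tprod_one_add_ne_zero_of_summable (f := fun n : ℕ => -(a * q ^ n))
    (fun n => by rw [← sub_eq_add_neg]; exact one_sub_mul_pow_ne_zero hq ha n)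
    (summable_norm_mul_pow_of_norm_lt_one hq a)
  simpa only [qPochInf, ← sub_eq_add_neg] using h

/-- The coefficients `∏_{j<n} (u - v q^j) / (1 - q^{j+1})` of the homogeneous `q`-binomial series. -/
noncomputable def qBinomialCoeff (u v q : ℂ) (n : ℕ) : ℂ :=
  ∏ j ∈ range n, (u - v * q ^ j) / (1 - q ^ (j + 1))

@[simp]
lemma qBinomialCoeff_zero (u v q : ℂ) : qBinomialCoeff u v q 0 = 1 := by
  simp [qBinomialCoeff]

lemma qBinomialCoeff_succ (u v q : ℂ) (n : ℕ) :
    qBinomialCoeff u v q (n + 1) =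
      qBinomialCoeff u v q n * ((u - v * q ^ n) / (1 - q ^ (n + 1))) :=
  prod_range_succ _ _

lemma summable_norm_qBinomialCoeff {q u z : ℂ} (hq : ‖q‖ < 1) (v : ℂ) (hz : ‖u * z‖ < 1) :
    Summable fun n => ‖qBinomialCoeff u v q n * z ^ n‖ := by
  obtain ⟨r, hr, hr1⟩ := exists_between hz
  have hpow : Tendsto (fun n : ℕ => q ^ n) atTop (𝓝 0) := tendsto_pow_atTop_nhds_zero_of_norm_lt_one hq
  have hlim : Tendsto (fun n : ℕ => ‖(u - v * q ^ n) / (1 - q ^ (n + 1)) * z‖) atTop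
      (𝓝 ‖(u - v * 0) / (1 - 0) * z‖) :=
    (((tendsto_const_nhds.sub (hpow.const_mul v)).div
      (tendsto_const_nhds.sub ((tendsto_add_atTop_iff_nat 1).2 hpow)) (by simp)).mul_const z).norm
  simp only [mul_zero, sub_zero, div_one] at hlim
  refine summable_of_ratio_norm_eventually_le hr1 ?_
  filter_upwards [hlim.eventually (ge_mem_nhds hr)] with n hn
  rw [norm_norm, norm_norm, qBinomialCoeff_succ, pow_succ z,
    show qBinomialCoeff u v q n * ((u - v * q ^ n) / (1 - q ^ (n + 1))) * (z ^ n * z) =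
      ((u - v * q ^ n) / (1 - q ^ (n + 1)) * z) * (qBinomialCoeff u v q n * z ^ n) by ring, norm_mul]
  exact mul_le_mul_of_nonneg_right hn (norm_nonneg _)

/-- The series of the `q`-binomial theorem satisfies a first order `q`-difference equation. -/
lemma one_sub_mul_tsum_qBinomialCoeff {q u z : ℂ} (hq : ‖q‖ < 1) (v : ℂ) (hz : ‖u * z‖ < 1) :
    (1 - u * z) * ∑' n, qBinomialCoeff u v q n * z ^ n =
      (1 - v * z) * ∑' n, qBinomialCoeff u v q n * (z * q) ^ n := by
  have hzq : ‖u * (z * q)‖ < 1 := by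
    rw [← mul_assoc, norm_mul]
    exact mul_lt_one_of_nonneg_of_lt_one_left (norm_nonneg _) hz hq.le
  have hf : Summable fun n => qBinomialCoeff u v q n * z ^ n :=
    (summable_norm_qBinomialCoeff hq v hz).of_norm
  have hg : Summable fun n => qBinomialCoeff u v q n * (z * q) ^ n :=
    (summable_norm_qBinomialCoeff hq v hzq).of_norm
  have hf1 := hf.tsum_eq_zero_add
  have hg1 := hg.tsum_eq_zero_add
  have key : ∑' n, qBinomialCoeff u v q (n + 1) * z ^ (n + 1) -
        ∑' n, qBinomialCoeff u v q (n + 1) * (z * q) ^ (n + 1) =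
      u * z * ∑' n, qBinomialCoeff u v q n * z ^ n -
        v * z * ∑' n, qBinomialCoeff u v q n * (z * q) ^ n := by
    rw [← ((summable_nat_add_iff 1).2 hf).tsum_sub ((summable_nat_add_iff 1).2 hg),
      ← tsum_mul_left, ← tsum_mul_left, ← (hf.mul_left _).tsum_sub (hg.mul_left _)]
    refine tsum_congr fun n => ?_
    have hne := one_sub_pow_succ_ne_zero hq n
    rw [qBinomialCoeff_succ, mul_pow, mul_pow]
    field_simp
    ring
  simp only [qBinomialCoeff_zero, pow_zero, mul_one] at hf1 hg1
  linear_combination hf1 - hg1 + key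

/-- The `q`-binomial theorem, in homogeneous form. -/
lemma tsum_qBinomialCoeff {q u z : ℂ} (hq : ‖q‖ < 1) (v : ℂ) (hz : ‖u * z‖ < 1) :
    ∑' n, qBinomialCoeff u v q n * z ^ n = qPochInf (v * z) q / qPochInf (u * z) q := by
  rw [eq_div_iff (qPochInf_ne_zero hq hz)]
  have hle : ∀ N : ℕ, ‖q ^ N‖ ≤ 1 := fun N => by
    rw [norm_pow]; exact pow_le_one₀ (norm_nonneg q) hq.le
  have hN : ∀ N : ℕ, ‖u * (z * q ^ N)‖ < 1 := fun N => by
    rw [← mul_assoc]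
    exact norm_mul_pow_lt_one hq hz N
  have hiter : ∀ N : ℕ, (∑' n, qBinomialCoeff u v q n * z ^ n) *
      ∏ j ∈ range N, (1 - u * z * q ^ j) =
      (∏ j ∈ range N, (1 - v * z * q ^ j)) * ∑' n, qBinomialCoeff u v q n * (z * q ^ N) ^ n := by
    intro N
    induction N with
    | zero => simp
    | succ N ih =>
      have h := one_sub_mul_tsum_qBinomialCoeff hq v (hN N)
      rw [mul_assoc z, ← pow_succ] at h
      rw [prod_range_succ, prod_range_succ]
      linear_combination (1 - u * z * q ^ N) * ih + (∏ j ∈ range N, (1 - v * z * q ^ j)) * h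
  have hpow : Tendsto (fun n : ℕ => q ^ n) atTop (𝓝 0) :=
    tendsto_pow_atTop_nhds_zero_of_norm_lt_one hq
  have hlim : Tendsto (fun N : ℕ => ∑' n, qBinomialCoeff u v q n * (z * q ^ N) ^ n) atTop
      (𝓝 (∑' n, qBinomialCoeff u v q n * (z * 0) ^ n)) := by
    refine tendsto_tsum_of_dominated_convergence (summable_norm_qBinomialCoeff hq v hz)
      (fun n => ((hpow.const_mul z).pow n).const_mul _) (Eventually.of_forall fun N n => ?_)
    rw [mul_pow, ← mul_assoc, norm_mul, norm_pow]
    exact mul_le_of_le_one_right (norm_nonneg _) (pow_le_one₀ (norm_nonneg _) (hle N))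
  have hone : ∑' n, qBinomialCoeff u v q n * (z * 0) ^ n = 1 := by
    rw [tsum_eq_single 0 fun n hn => by simp [hn]]
    simp
  rw [hone] at hlim
  have h := (tendsto_prod_qPochInf hq (v * z)).mul hlim
  rw [mul_one] at h
  exact tendsto_nhds_unique
    (((tendsto_prod_qPochInf hq (u * z)).const_mul _).congr hiter) h

lemma summable_norm_euler {q z : ℂ} (hq : ‖q‖ < 1) (hz : ‖z‖ < 1) :
    Summable fun n => ‖qBinomialCoeff 1 0 q n * z ^ n‖ :=
  summable_norm_qBinomialCoeff hq 0 (by rwa [one_mul])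

/-- Euler's expansion of `1 / (z; q)_∞`. -/
lemma tsum_euler_inv {q z : ℂ} (hq : ‖q‖ < 1) (hz : ‖z‖ < 1) :
    ∑' n, qBinomialCoeff 1 0 q n * z ^ n = (qPochInf z q)⁻¹ := by
  rw [tsum_qBinomialCoeff hq 0 (by rwa [one_mul]), one_mul, zero_mul, ← one_div]
  simp [qPochInf]

lemma summable_norm_euler_theta {q : ℂ} (hq : ‖q‖ < 1) (z : ℂ) :
    Summable fun n => ‖qBinomialCoeff 0 (-1) q n * z ^ n‖ :=
  summable_norm_qBinomialCoeff hq (-1) (by simp)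

/-- Euler's expansion of `(-z; q)_∞`. -/
lemma tsum_euler {q : ℂ} (hq : ‖q‖ < 1) (z : ℂ) :
    ∑' n, qBinomialCoeff 0 (-1) q n * z ^ n = qPochInf (-z) q := by
  rw [tsum_qBinomialCoeff hq (-1) (by simp), zero_mul, neg_one_mul]
  simp [qPochInf]

lemma pow_succ_sq (s : ℂ) (n : ℕ) : s ^ ((n + 1) ^ 2) = s ^ (n ^ 2) * (s ^ 2) ^ n * s := by
  ring

lemma qBinomialCoeff_zero_neg_one_mul_pow (s : ℂ) (n : ℕ) :
    qBinomialCoeff 0 (-1) (s ^ 2) n * s ^ n = qBinomialCoeff 1 0 (s ^ 2) n * s ^ (n ^ 2) := by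
  induction n with
  | zero => simp
  | succ n ih =>
    rw [qBinomialCoeff_succ, qBinomialCoeff_succ, pow_succ_sq, pow_succ s n]
    linear_combination ((s ^ 2) ^ n / (1 - (s ^ 2) ^ (n + 1)) * s) * ih

lemma qBinomialCoeff_div_qPochInf {q b : ℂ} (hq : ‖q‖ < 1) (hb : ‖b‖ < 1) (n : ℕ) :
    qBinomialCoeff 1 0 q n / qPochInf (b * q ^ n) q =
      qBinomialCoeff 1 b q n / qPochInf b q := by
  induction n with
  | zero => simp
  | succ n ih =>
    have h := qPochInf_eq_one_sub_mul hq (b * q ^ n)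
    have h1 := qPochInf_ne_zero hq (norm_mul_pow_lt_one hq hb n)
    have h2 := qPochInf_ne_zero hq (norm_mul_pow_lt_one hq hb (n + 1))
    have h3 := qPochInf_ne_zero hq hb
    rw [mul_assoc, ← pow_succ] at h
    rw [div_eq_div_iff h1 h3, h] at ih
    rw [div_eq_div_iff h2 h3, qBinomialCoeff_succ, qBinomialCoeff_succ]
    linear_combination (1 / (1 - q ^ (n + 1))) * ih

lemma tsum_prod_euler_mul_pow {q a b : ℂ} (hq : ‖q‖ < 1) (ha : ‖a‖ < 1) (hb : ‖b‖ < 1) :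
    ∑' p : ℕ × ℕ, (qBinomialCoeff 1 0 q p.1 * a ^ p.1) * (qBinomialCoeff 1 0 q p.2 * b ^ p.2) *
        q ^ (p.1 * p.2) =
      qPochInf (a * b) q / (qPochInf a q * qPochInf b q) := by
  have hs : Summable fun p : ℕ × ℕ => (qBinomialCoeff 1 0 q p.1 * a ^ p.1) *
      (qBinomialCoeff 1 0 q p.2 * b ^ p.2) * q ^ (p.1 * p.2) := by
    refine Summable.of_norm_bounded
      ((summable_norm_euler hq ha).mul_norm (summable_norm_euler hq hb)) fun p => ?_
    rw [norm_mul, norm_pow q]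
    exact mul_le_of_le_one_right (norm_nonneg _) (pow_le_one₀ (norm_nonneg q) hq.le)
  rw [hs.tsum_prod]
  have hrow : ∀ k : ℕ, ∑' l : ℕ, (qBinomialCoeff 1 0 q k * a ^ k) *
      (qBinomialCoeff 1 0 q l * b ^ l) * q ^ (k * l) =
      (qPochInf b q)⁻¹ * (qBinomialCoeff 1 b q k * a ^ k) := fun k => by
    have h1 := tsum_euler_inv hq (norm_mul_pow_lt_one hq hb k)
    have h2 := qBinomialCoeff_div_qPochInf hq hb k
    rw [div_eq_mul_inv, div_eq_mul_inv, ← h1] at h2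
    rw [← mul_assoc, mul_comm (qPochInf b q)⁻¹, ← h2, mul_right_comm, ← tsum_mul_left]
    refine tsum_congr fun l => ?_
    rw [mul_pow, pow_mul]
    ring
  simp only [hrow]
  rw [tsum_mul_left, tsum_qBinomialCoeff hq b (by rwa [one_mul]), one_mul, mul_comm b a]
  ring

lemma qBinomialCoeff_mul_qPochInf_zpow {s d : ℂ} (hs0 : s ≠ 0) (hs : ‖s ^ 2‖ < 1) (c : ℂ) (n : ℕ) :
    qBinomialCoeff 1 0 (s ^ 2) n * (-(s * c)) ^ n * s ^ (n ^ 2) *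
        qPochInf (s ^ 2 * d * ((s ^ 2) ^ n)⁻¹) (s ^ 2) =
      qPochInf (s ^ 2 * d) (s ^ 2) * (qBinomialCoeff d 1 (s ^ 2) n * (s ^ 2 * c) ^ n) := by
  induction n with
  | zero => simp
  | succ n ih =>
    have h := qPochInf_eq_one_sub_mul hs (s ^ 2 * d * ((s ^ 2) ^ (n + 1))⁻¹)
    have h5 : s ^ 2 * d * ((s ^ 2) ^ (n + 1))⁻¹ * s ^ 2 = s ^ 2 * d * ((s ^ 2) ^ n)⁻¹ := by
      rw [pow_succ]
      field_simp
      ring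
    have h6 : (1 - s ^ 2 * d * ((s ^ 2) ^ (n + 1))⁻¹) * (s ^ 2) ^ n = (s ^ 2) ^ n - d := by
      rw [pow_succ]
      field_simp
      ring
    rw [h5] at h
    rw [h, qBinomialCoeff_succ, qBinomialCoeff_succ, pow_succ_sq,
      pow_succ (-(s * c)), pow_succ (s ^ 2 * c)]
    linear_combination (-(s ^ 2 * c) * ((s ^ 2) ^ n - d) / (1 - (s ^ 2) ^ (n + 1))) * ih -
      (qBinomialCoeff 1 0 (s ^ 2) n * (-(s * c)) ^ n * s ^ (n ^ 2) *
        qPochInf (s ^ 2 * d * ((s ^ 2) ^ n)⁻¹) (s ^ 2)) * (s ^ 2 * c) /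
          (1 - (s ^ 2) ^ (n + 1)) * h6

lemma tsum_prod_euler_mul_zpow {s c d : ℂ} (hs0 : s ≠ 0) (hs : ‖s‖ < 1) (hc : ‖s * c‖ < 1)
    (hd : ‖s * d‖ < 1) :
    ∑' p : ℕ × ℕ, (qBinomialCoeff 1 0 (s ^ 2) p.1 * (-(s * c)) ^ p.1) *
        (qBinomialCoeff 1 0 (s ^ 2) p.2 * (-(s * d)) ^ p.2) * s ^ (((p.2 : ℤ) - p.1) ^ 2) =
      qPochInf (s ^ 2 * c) (s ^ 2) * qPochInf (s ^ 2 * d) (s ^ 2) /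
        qPochInf (s ^ 2 * c * d) (s ^ 2) := by
  have hq : ‖s ^ 2‖ < 1 := by
    rw [norm_pow]; exact pow_lt_one₀ (norm_nonneg s) hs two_ne_zero
  have hsum : Summable fun p : ℕ × ℕ => (qBinomialCoeff 1 0 (s ^ 2) p.1 * (-(s * c)) ^ p.1) *
      (qBinomialCoeff 1 0 (s ^ 2) p.2 * (-(s * d)) ^ p.2) * s ^ (((p.2 : ℤ) - p.1) ^ 2) := by
    refine Summable.of_norm_bounded ((summable_norm_euler hq (z := -(s * c)) (by rwa [norm_neg])).mul_norm
      (summable_norm_euler hq (z := -(s * d)) (by rwa [norm_neg]))) fun p => ?_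
    rw [norm_mul, norm_zpow s]
    refine mul_le_of_le_one_right (norm_nonneg _) ?_
    obtain ⟨m, hm⟩ := Int.eq_ofNat_of_zero_le (sq_nonneg ((p.2 : ℤ) - p.1))
    rw [hm, zpow_natCast]
    exact pow_le_one₀ (norm_nonneg s) hs.le
  rw [hsum.tsum_prod]
  have hrow : ∀ k : ℕ, ∑' l : ℕ, (qBinomialCoeff 1 0 (s ^ 2) k * (-(s * c)) ^ k) *
      (qBinomialCoeff 1 0 (s ^ 2) l * (-(s * d)) ^ l) * s ^ (((l : ℤ) - k) ^ 2) =
      qPochInf (s ^ 2 * d) (s ^ 2) * (qBinomialCoeff d 1 (s ^ 2) k * (s ^ 2 * c) ^ k) := fun k => by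
    have h1 := tsum_euler hq (-(s ^ 2 * d * ((s ^ 2) ^ k)⁻¹))
    rw [neg_neg] at h1
    rw [← qBinomialCoeff_mul_qPochInf_zpow hs0 hq, ← h1, ← tsum_mul_left]
    refine tsum_congr fun l => ?_
    have h2 := qBinomialCoeff_zero_neg_one_mul_pow s l
    have h3 : s ^ (((l : ℤ) - k) ^ 2) = s ^ (l ^ 2) * s ^ (k ^ 2) * (((s ^ 2) ^ k)⁻¹) ^ l := by
      rw [show ((l : ℤ) - k) ^ 2 = ((l ^ 2 : ℕ) : ℤ) + ((k ^ 2 : ℕ) : ℤ) + -((2 * k * l : ℕ) : ℤ) by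
        push_cast; ring, zpow_add₀ hs0, zpow_add₀ hs0, zpow_neg, zpow_natCast, zpow_natCast,
        zpow_natCast, pow_mul, pow_mul, inv_pow]
    rw [h3, show -(s ^ 2 * d * ((s ^ 2) ^ k)⁻¹) = s * (-(s * d)) * ((s ^ 2) ^ k)⁻¹ by ring,
      mul_pow, mul_pow s]
    linear_combination (-(qBinomialCoeff 1 0 (s ^ 2) k * (-(s * c)) ^ k * s ^ (k ^ 2) *
      (-(s * d)) ^ l * (((s ^ 2) ^ k)⁻¹) ^ l)) * h2
  have hdc : ‖d * (s ^ 2 * c)‖ < 1 := by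
    rw [show d * (s ^ 2 * c) = (s * c) * (s * d) by ring, norm_mul]
    exact mul_lt_one_of_nonneg_of_lt_one_left (norm_nonneg _) hc hd.le
  simp only [hrow]
  rw [tsum_mul_left, tsum_qBinomialCoeff hq 1 hdc, one_mul, mul_comm d]
  ring

lemma integral_tsum_shift_mul {g H : ℝ → ℂ} {C : ℝ} {A : ℕ × ℕ → ℂ} (hg : Integrable g)
    (hH : Continuous H) (hC : ∀ x, ‖H x‖ ≤ C) (hper : ∀ x, H (x + 1) = H x)
    (hA : Summable fun p => ‖A p‖) :
    ∫ x : ℝ, (∑' p : ℕ × ℕ, A p * g (x + (p.1 - p.2))) * H x =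
      (∑' p, A p) * ∫ x : ℝ, g x * H x := by
  have hgH : Integrable fun x => g x * H x :=
    hg.mul_bdd hH.aestronglyMeasurable (Eventually.of_forall hC)
  have hshift : ∀ (p : ℕ × ℕ) (x : ℝ), H x = H (x + (p.1 - p.2)) := fun p x => by
    have h : Function.Periodic H 1 := hper
    have h1 := h.int_mul ((p.1 : ℤ) - p.2) x
    rw [← h1]
    push_cast
    rw [mul_one]
  have hF : ∀ x : ℝ, (∑' p : ℕ × ℕ, A p * g (x + (p.1 - p.2))) * H x =
      ∑' p : ℕ × ℕ, A p * (fun y => g y * H y) (x + (p.1 - p.2)) := fun x => by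
    rw [← tsum_mul_right]
    refine tsum_congr fun p => ?_
    rw [mul_assoc]
    nth_rw 1 [hshift p x]
  simp only [hF]
  have h := hasSum_integral_of_summable_integral_norm (μ := volume)
    (F := fun (p : ℕ × ℕ) (x : ℝ) => A p * (fun y => g y * H y) (x + (p.1 - p.2)))
    (fun p => (hgH.comp_add_right _).const_mul _) (by
      have h1 : ∀ p : ℕ × ℕ, ∫ x : ℝ, ‖A p * (fun y => g y * H y) (x + (p.1 - p.2))‖ =
          ‖A p‖ * ∫ x : ℝ, ‖g x * H x‖ := fun p => by
        simp only [norm_mul (A p)]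
        rw [integral_const_mul]
        exact congrArg _ (integral_add_right_eq_self (fun x => ‖g x * H x‖) _)
      simp only [h1]
      exact hA.mul_right _)
  rw [← h.tsum_eq, ← tsum_mul_right]
  refine tsum_congr fun p => ?_
  rw [integral_const_mul]
  exact congrArg _ (integral_add_right_eq_self (fun x => g x * H x) _)

lemma qPochInf_mul_qPochInf_mul_gaussian {τ : ℂ} (hq : ‖Complex.exp (2 * π * Complex.I * τ)‖ < 1)
    (a b : ℂ) (x : ℝ) :
    qPochInf (-a * Complex.exp (2 * π * Complex.I * τ * (1 / 2 + x)))
          (Complex.exp (2 * π * Complex.I * τ)) *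
        qPochInf (-b * Complex.exp (2 * π * Complex.I * τ * (1 / 2 - x)))
          (Complex.exp (2 * π * Complex.I * τ)) *
        Complex.exp (π * Complex.I * τ * (x : ℂ) ^ 2) =
      ∑' p : ℕ × ℕ, (qBinomialCoeff 1 0 (Complex.exp (2 * π * Complex.I * τ)) p.1 * a ^ p.1) *
        (qBinomialCoeff 1 0 (Complex.exp (2 * π * Complex.I * τ)) p.2 * b ^ p.2) *
        Complex.exp (2 * π * Complex.I * τ) ^ (p.1 * p.2) *
        Complex.exp (π * Complex.I * τ * ((x + (p.1 - p.2) : ℝ) : ℂ) ^ 2) := by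
  set r := Complex.exp (π * Complex.I * τ) with hr
  have hqr : Complex.exp (2 * π * Complex.I * τ) = r ^ 2 := by
    rw [hr, ← Complex.exp_nat_mul]
    congr 1
    push_cast
    ring
  rw [hqr] at hq ⊢
  set E := Complex.exp (2 * π * Complex.I * τ * x) with hE
  have hX : Complex.exp (2 * π * Complex.I * τ * (1 / 2 + x)) = r * E := by
    rw [hr, hE, ← Complex.exp_add]
    congr 1
    ring
  have hY : Complex.exp (2 * π * Complex.I * τ * (1 / 2 - x)) = r * E⁻¹ := by
    rw [hr, hE, ← Complex.exp_neg, ← Complex.exp_add]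
    congr 1
    ring
  rw [hX, hY, neg_mul, neg_mul, ← tsum_euler hq, ← tsum_euler hq,
    tsum_mul_tsum_of_summable_norm (summable_norm_euler_theta hq _)
      (summable_norm_euler_theta hq _), ← tsum_mul_right]
  refine tsum_congr fun p => ?_
  obtain ⟨k, l⟩ := p
  have hk := qBinomialCoeff_zero_neg_one_mul_pow r k
  have hl := qBinomialCoeff_zero_neg_one_mul_pow r l
  have hg : (r ^ 2) ^ (k * l) * Complex.exp (π * Complex.I * τ * ((x + (k - l) : ℝ) : ℂ) ^ 2) =
      r ^ (k ^ 2) * r ^ (l ^ 2) * E ^ k * E⁻¹ ^ l * Complex.exp (π * Complex.I * τ * (x : ℂ) ^ 2) := by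
    rw [hr, hE, ← Complex.exp_neg]
    simp only [← Complex.exp_nat_mul, ← Complex.exp_add]
    congr 1
    push_cast
    ring
  dsimp only
  rw [mul_assoc _ ((r ^ 2) ^ (k * l)), hg, ← mul_assoc a, ← mul_assoc b, mul_pow _ E,
    mul_pow _ E⁻¹, mul_pow a, mul_pow b]
  linear_combination (a ^ k * E ^ k * qBinomialCoeff 0 (-1) (r ^ 2) l * b ^ l * r ^ l * E⁻¹ ^ l *
      Complex.exp (π * Complex.I * τ * (x : ℂ) ^ 2)) * hk +
    (qBinomialCoeff 1 0 (r ^ 2) k * r ^ (k ^ 2) * a ^ k * E ^ k * b ^ l * E⁻¹ ^ l *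
      Complex.exp (π * Complex.I * τ * (x : ℂ) ^ 2)) * hl

lemma inv_qPochInf_mul_qPochInf {q u v w : ℂ} (hq : ‖q‖ < 1) (hu : ‖u‖ < 1) (hv : ‖v‖ < 1)
    (hw : ‖w‖ = 1) :
    (qPochInf (u * w⁻¹) q * qPochInf (v * w) q)⁻¹ =
      ∑' p : ℕ × ℕ, (qBinomialCoeff 1 0 q p.1 * u ^ p.1) * (qBinomialCoeff 1 0 q p.2 * v ^ p.2) *
        w ^ ((p.2 : ℤ) - p.1) := by
  have hw0 : w ≠ 0 := norm_ne_zero_iff.1 (by rw [hw]; exact one_ne_zero)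
  have hu' : ‖u * w⁻¹‖ < 1 := by rwa [norm_mul, norm_inv, hw, inv_one, mul_one]
  have hv' : ‖v * w‖ < 1 := by rwa [norm_mul, hw, mul_one]
  rw [mul_inv, ← tsum_euler_inv hq hu', ← tsum_euler_inv hq hv',
    tsum_mul_tsum_of_summable_norm (summable_norm_euler hq hu') (summable_norm_euler hq hv')]
  refine tsum_congr fun p => ?_
  rw [zpow_sub₀ hw0, zpow_natCast, zpow_natCast, mul_pow, mul_pow, inv_pow]
  ring

lemma neg_I_mul_re (τ : ℂ) : (π * (-Complex.I * τ)).re = π * τ.im := by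
  simp

lemma gaussian_eq (τ : ℂ) (x : ℝ) : Complex.exp (π * Complex.I * τ * (x : ℂ) ^ 2) =
    Complex.exp (-(π * (-Complex.I * τ)) * (x : ℂ) ^ 2) := by
  congr 1
  ring

lemma integrable_gaussian {τ : ℂ} (hτ : 0 < τ.im) :
    Integrable fun x : ℝ => Complex.exp (π * Complex.I * τ * (x : ℂ) ^ 2) := by
  simp only [gaussian_eq]
  exact integrable_cexp_neg_mul_sq (by rw [neg_I_mul_re]; positivity)

lemma integral_gaussian_mul_zpow {τ : ℂ} (hτ : 0 < τ.im) (m : ℤ) :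
    ∫ x : ℝ, Complex.exp (π * Complex.I * τ * (x : ℂ) ^ 2) *
        Complex.exp (2 * π * Complex.I * x) ^ m =
      ((-Complex.I * τ) ^ (1 / 2 : ℂ))⁻¹ * Complex.exp (-(π * Complex.I) / τ) ^ (m ^ 2) := by
  have hτ0 : τ ≠ 0 := fun h => by simp [h] at hτ
  have hre : 0 < (-Complex.I * τ).re := by simpa using hτ
  have h := fourierIntegral_gaussian (b := π * (-Complex.I * τ))
    (by rw [neg_I_mul_re]; positivity) (2 * π * m)
  have hpi : (π : ℂ) ≠ 0 := Complex.ofReal_ne_zero.2 Real.pi_ne_zero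
  have harg : (-Complex.I * τ).arg ≠ π := fun h => by
    have := (Complex.arg_eq_pi_iff.1 h).1
    linarith
  rw [div_mul_cancel_left₀ hpi, Complex.inv_cpow _ _ harg] at h
  rw [← Complex.exp_int_mul, show ((m ^ 2 : ℤ) : ℂ) * (-(π * Complex.I) / τ) =
    -(2 * π * m) ^ 2 / (4 * (π * (-Complex.I * τ))) by
      push_cast
      field_simp
      rw [Complex.I_sq]
      ring, ← h]
  refine integral_congr_ae (Eventually.of_forall fun x => ?_)
  dsimp only
  rw [gaussian_eq, mul_comm, ← Complex.exp_int_mul]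
  congr 2
  ring

lemma integral_gaussian_mul_tsum {τ : ℂ} (hτ : 0 < τ.im) {e : ℕ × ℕ → ℂ}
    (he : Summable fun p => ‖e p‖) :
    ∫ x : ℝ, Complex.exp (π * Complex.I * τ * (x : ℂ) ^ 2) *
        ∑' p : ℕ × ℕ, e p * Complex.exp (2 * π * Complex.I * x) ^ ((p.2 : ℤ) - p.1) =
      ((-Complex.I * τ) ^ (1 / 2 : ℂ))⁻¹ *
        ∑' p : ℕ × ℕ, e p * Complex.exp (-(π * Complex.I) / τ) ^ (((p.2 : ℤ) - p.1) ^ 2) := by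
  have hg := integrable_gaussian hτ
  have hnorm : ∀ (x : ℝ) (m : ℤ), ‖Complex.exp (2 * π * Complex.I * x) ^ m‖ = 1 := fun x m => by
    rw [norm_zpow, Complex.norm_exp]
    simp
  have hcont : ∀ m : ℤ, Continuous fun x : ℝ => Complex.exp (2 * π * Complex.I * x) ^ m := fun m =>
    Continuous.zpow₀ (by fun_prop) m fun x => Or.inl (Complex.exp_ne_zero _)
  have h := hasSum_integral_of_summable_integral_norm (μ := volume)
    (F := fun (p : ℕ × ℕ) (x : ℝ) => e p * (Complex.exp (π * Complex.I * τ * (x : ℂ) ^ 2) *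
      Complex.exp (2 * π * Complex.I * x) ^ ((p.2 : ℤ) - p.1)))
    (fun p => (hg.mul_bdd (c := 1) (hcont _).aestronglyMeasurable
      (Eventually.of_forall fun x => (hnorm x _).le)).const_mul _)
    (by
      simp only [norm_mul, hnorm, mul_one]
      simp only [integral_const_mul]
      exact he.mul_right _)
  rw [← tsum_mul_left]
  calc _ = ∫ x : ℝ, ∑' p : ℕ × ℕ, e p * (Complex.exp (π * Complex.I * τ * (x : ℂ) ^ 2) *
      Complex.exp (2 * π * Complex.I * x) ^ ((p.2 : ℤ) - p.1)) := by
        refine integral_congr_ae (Eventually.of_forall fun x => ?_)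
        dsimp only
        rw [← tsum_mul_left]
        exact tsum_congr fun p => mul_left_comm _ _ _
    _ = _ := by
        rw [← h.tsum_eq]
        refine tsum_congr fun p => ?_
        rw [integral_const_mul, integral_gaussian_mul_zpow hτ]
        ring

lemma norm_mul_lt_one_of_lt_rpow {s c : ℂ} (hs0 : s ≠ 0)
    (hc : ‖c‖ < ‖s ^ 2‖ ^ (-(1 / 2) : ℝ)) : ‖s * c‖ < 1 := by
  have hpos : 0 < ‖s‖ := norm_pos_iff.2 hs0
  rw [norm_pow, Real.rpow_neg (by positivity), ← Real.sqrt_eq_rpow, Real.sqrt_sq hpos.le] at hc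
  rw [norm_mul]
  calc ‖s‖ * ‖c‖ < ‖s‖ * ‖s‖⁻¹ := mul_lt_mul_of_pos_left hc hpos
    _ = 1 := mul_inv_cancel₀ hpos.ne'

/-- The fused Ramanujan integral: for `τ ∈ ℍ`, `q = exp(2πiτ)`, `q̃ = exp(-2πi/τ)`,
`0 < |a|,|b| < 1` and `|c|,|d| < |q̃|^{-1/2}`,
`∫_{-∞}^∞ (-aq^{1/2+x},-bq^{1/2-x};q)_∞ q^{x²/2} /
(-q̃^{1/2}ce^{-2πix},-q̃^{1/2}de^{2πix};q̃)_∞ dx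
= (1/√(-iτ)) (ab;q)_∞ (q̃c,q̃d;q̃)_∞ / ((q̃cd;q̃)_∞ (a,b;q)_∞)`. -/
theorem fused_ramanujan_integral (τ a b c d : ℂ) (hτ : 0 < τ.im)
    (q qt : ℂ) (hq : q = Complex.exp (2 * (π : ℂ) * Complex.I * τ))
    (hqt : qt = Complex.exp (-(2 * (π : ℂ) * Complex.I) / τ))
    (ha0 : a ≠ 0) (hb0 : b ≠ 0) (ha : ‖a‖ < 1) (hb : ‖b‖ < 1)
    (hc : ‖c‖ < ‖qt‖ ^ (-(1 / 2) : ℝ)) (hd : ‖d‖ < ‖qt‖ ^ (-(1 / 2) : ℝ)) :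
    (∫ x : ℝ,
      (qPochInf (-a * Complex.exp (2 * (π : ℂ) * Complex.I * τ * (1 / 2 + (x : ℂ)))) q *
        qPochInf (-b * Complex.exp (2 * (π : ℂ) * Complex.I * τ * (1 / 2 - (x : ℂ)))) q *
        Complex.exp ((π : ℂ) * Complex.I * τ * (x : ℂ) ^ 2)) /
      (qPochInf (-(Complex.exp (-((π : ℂ) * Complex.I) / τ)) * c *
          Complex.exp (-(2 * (π : ℂ) * Complex.I * (x : ℂ)))) qt *
        qPochInf (-(Complex.exp (-((π : ℂ) * Complex.I) / τ)) * d *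
          Complex.exp (2 * (π : ℂ) * Complex.I * (x : ℂ))) qt)) =
    ((-Complex.I * τ) ^ (1 / 2 : ℂ))⁻¹ *
      (qPochInf (a * b) q * qPochInf (qt * c) qt * qPochInf (qt * d) qt) /
      (qPochInf (qt * c * d) qt * qPochInf a q * qPochInf b q) := by
  set s := Complex.exp (-((π : ℂ) * Complex.I) / τ) with hs
  have hs0 : s ≠ 0 := Complex.exp_ne_zero _
  have hqs : qt = s ^ 2 := by
    rw [hqt, hs, ← Complex.exp_nat_mul]
    congr 1
    push_cast
    ring
  have hτ0 : τ ≠ 0 := fun h => by simp [h] at hτ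
  have hs1 : ‖s‖ < 1 := by
    rw [hs, Complex.norm_exp, Real.exp_lt_one_iff, Complex.div_re]
    have : 0 < π * τ.im / Complex.normSq τ :=
      div_pos (mul_pos Real.pi_pos hτ) (Complex.normSq_pos.2 hτ0)
    simpa [neg_div] using this
  have hq1 : ‖q‖ < 1 := by
    rw [hq, Complex.norm_exp, Real.exp_lt_one_iff]
    have : 0 < 2 * π * τ.im := by positivity
    simpa using this
  subst hqs
  have hqt1 : ‖s ^ 2‖ < 1 := by
    rw [norm_pow]
    exact pow_lt_one₀ (norm_nonneg s) hs1 two_ne_zero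
  have hsc := norm_mul_lt_one_of_lt_rpow hs0 hc
  have hsd := norm_mul_lt_one_of_lt_rpow hs0 hd
  have hu : ‖-(s * c)‖ < 1 := by rwa [norm_neg]
  have hv : ‖-(s * d)‖ < 1 := by rwa [norm_neg]
  have he := (summable_norm_euler hqt1 hu).mul_norm (summable_norm_euler hqt1 hv)
  have hw : ∀ (x : ℝ) (m : ℤ), ‖Complex.exp (2 * π * Complex.I * x) ^ m‖ = 1 := fun x m => by
    rw [norm_zpow, Complex.norm_exp]
    simp
  have hden : ∀ x : ℝ, (qPochInf (-s * c * Complex.exp (-(2 * (π : ℂ) * Complex.I * (x : ℂ)))) (s ^ 2) *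
      qPochInf (-s * d * Complex.exp (2 * (π : ℂ) * Complex.I * (x : ℂ))) (s ^ 2))⁻¹ =
      ∑' p : ℕ × ℕ, (qBinomialCoeff 1 0 (s ^ 2) p.1 * (-(s * c)) ^ p.1) *
        (qBinomialCoeff 1 0 (s ^ 2) p.2 * (-(s * d)) ^ p.2) *
        Complex.exp (2 * π * Complex.I * x) ^ ((p.2 : ℤ) - p.1) := fun x => by
    rw [← inv_qPochInf_mul_qPochInf hqt1 hu hv (by simpa using hw x 1), Complex.exp_neg,
      neg_mul s, neg_mul s]
  have hbound : ∀ (p : ℕ × ℕ) (x : ℝ), ‖(qBinomialCoeff 1 0 (s ^ 2) p.1 * (-(s * c)) ^ p.1) *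
        (qBinomialCoeff 1 0 (s ^ 2) p.2 * (-(s * d)) ^ p.2) *
        Complex.exp (2 * π * Complex.I * x) ^ ((p.2 : ℤ) - p.1)‖ ≤
      ‖(qBinomialCoeff 1 0 (s ^ 2) p.1 * (-(s * c)) ^ p.1) *
        (qBinomialCoeff 1 0 (s ^ 2) p.2 * (-(s * d)) ^ p.2)‖ := fun p x => by
    rw [norm_mul, hw, mul_one]
  have hA : Summable fun p : ℕ × ℕ => ‖(qBinomialCoeff 1 0 q p.1 * a ^ p.1) *
      (qBinomialCoeff 1 0 q p.2 * b ^ p.2) * q ^ (p.1 * p.2)‖ := by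
    refine Summable.of_nonneg_of_le (fun _ => norm_nonneg _) (fun p => ?_)
      ((summable_norm_euler hq1 ha).mul_norm (summable_norm_euler hq1 hb))
    rw [norm_mul, norm_pow q]
    exact mul_le_of_le_one_right (norm_nonneg _) (pow_le_one₀ (norm_nonneg q) hq1.le)
  have hnum := qPochInf_mul_qPochInf_mul_gaussian (hq ▸ hq1) a b
  rw [← hq] at hnum
  have hcont : Continuous fun x : ℝ => ∑' p : ℕ × ℕ,
      (qBinomialCoeff 1 0 (s ^ 2) p.1 * (-(s * c)) ^ p.1) *
        (qBinomialCoeff 1 0 (s ^ 2) p.2 * (-(s * d)) ^ p.2) *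
        Complex.exp (2 * π * Complex.I * x) ^ ((p.2 : ℤ) - p.1) :=
    continuous_tsum (fun p => continuous_const.mul (Continuous.zpow₀ (by fun_prop) _
      fun x => Or.inl (Complex.exp_ne_zero _))) he hbound
  simp only [div_eq_mul_inv _ (qPochInf _ _ * qPochInf _ _), hden, hnum]
  rw [integral_tsum_shift_mul (integrable_gaussian hτ) hcont
    (fun x => tsum_of_norm_bounded he.hasSum fun p => hbound p x)
    (fun x => by
      push_cast
      rw [mul_add, mul_one, Complex.exp_periodic]) hA,
    integral_gaussian_mul_tsum hτ he, tsum_prod_euler_mul_pow hq1 ha hb, ← hs,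
    tsum_prod_euler_mul_zpow hs0 hs1 hsc hsd]
  ring
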